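/- There exists an optimal mechanism of monotone threshold form: there are a feasible mechanism x*, a function κ : [L,R] → [0,1], and a function τ : [L,R] → [0,∞) such that for all s ∈ [L,R] and y ∈ [0,1]^(n−1), x*(s,y) = κ(s) if ∏_{k=1}^{n−1} y_k ≥ τ(s)·∏_{k=1}^{n−1}(1−y_k) and x*(s,y) = 0 otherwise, and V(x) ≤ V(x*) for every feasible mechanism x. -/

import Mathlib

open MeasureTheory Set Filter

noncomputable section

/-- The unit cube `[0,1]^m` inside `Fin m → ℝ`. -/
def cube (m : ℕ) : Set (Fin m → ℝ) := Set.univ.pi fun _ => Set.Icc (0:ℝ) 1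

/-- `w⁺(y) = ∏ y_k · f(y_k)`. -/
def wplus (f : ℝ → ℝ) {m : ℕ} (y : Fin m → ℝ) : ℝ := ∏ k, y k * f (y k)

/-- `w⁻(y) = ∏ (1 - y_k) · f(y_k)`. -/
def wminus (f : ℝ → ℝ) {m : ℕ} (y : Fin m → ℝ) : ℝ := ∏ k, (1 - y k) * f (y k)

/-- Hypotheses on the signal density `f` with derivative `f'` on `[L,R]`. -/
structure Density (f f' : ℝ → ℝ) (L R : ℝ) : Prop where
  nonneg : ∀ s, 0 ≤ f s
  zero_outside : ∀ s ∉ Set.Icc L R, f s = 0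
  pos : ∀ s ∈ Set.Icc L R, 0 < f s
  hderiv : ∀ s ∈ Set.Icc L R, HasDerivWithinAt f (f' s) (Set.Icc L R) s
  cont_deriv : ContinuousOn f' (Set.Icc L R)
  total : (∫ s in L..R, f s) = 1
  mean : (∫ s in L..R, s * f s) = 1 / 2

/-- A mechanism is measurable with values in `[0,1]`. -/
def IsMechanism {m : ℕ} (x : ℝ → (Fin m → ℝ) → ℝ) : Prop :=
  Measurable (Function.uncurry x) ∧ ∀ s y, x s y ∈ Set.Icc (0:ℝ) 1

/-- `A(t) = ∫_{[0,1]^m} x(t,y) w⁺(y) dy`. -/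
def Amap (f : ℝ → ℝ) {m : ℕ} (x : ℝ → (Fin m → ℝ) → ℝ) (t : ℝ) : ℝ :=
  ∫ y in cube m, x t y * wplus f y

/-- `B(t) = ∫_{[0,1]^m} x(t,y) w⁻(y) dy`. -/
def Bmap (f : ℝ → ℝ) {m : ℕ} (x : ℝ → (Fin m → ℝ) → ℝ) (t : ℝ) : ℝ :=
  ∫ y in cube m, x t y * wminus f y

/-- Interim payoff `U_x(t;s) = 2^m (s A(t) - (1-s) B(t))` (with `m = n-1`). -/
def Upay (f : ℝ → ℝ) {m : ℕ} (x : ℝ → (Fin m → ℝ) → ℝ) (t s : ℝ) : ℝ :=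
  2 ^ m * (s * Amap f x t - (1 - s) * Bmap f x t)

/-- Feasibility: mechanism + participation + incentive compatibility on `[L,R]`. -/
def Feasible (f : ℝ → ℝ) (L R : ℝ) {m : ℕ} (x : ℝ → (Fin m → ℝ) → ℝ) : Prop :=
  IsMechanism x ∧ (∀ s ∈ Set.Icc L R, 0 ≤ Upay f x s s) ∧
    (∀ s ∈ Set.Icc L R, ∀ t ∈ Set.Icc L R, Upay f x t s ≤ Upay f x s s)

/-- The designer's value `V(x)`. -/
def Value (f : ℝ → ℝ) (L R : ℝ) {m : ℕ} (x : ℝ → (Fin m → ℝ) → ℝ) : ℝ :=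
  2 ^ m * ∫ s in L..R, (s * Amap f x s + (1 - s) * Bmap f x s) * f s

/-- The first-best utility `Ubar`. -/
def Ubar (f : ℝ → ℝ) (m : ℕ) (s : ℝ) : ℝ :=
  2 ^ m * ∫ y in cube m, max (s * wplus f y - (1 - s) * wminus f y) 0

lemma null_aux (k : ℕ) : ∀ τ : ℝ, volume {y : Fin (k+1) → ℝ | τ * ∏ i, (1 - y i) = ∏ i, y i} = 0 := by
  induction k with
  | zero =>
    intro τ
    have hs : {y : Fin (0+1) → ℝ | τ * ∏ i, (1 - y i) = ∏ i, y i} ⊆ {y | y 0 = τ / (1 + τ)} := by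
      intro y hy
      have hy : τ * ∏ i : Fin (0+1), (1 - y i) = ∏ i, y i := hy
      rw [Fin.prod_univ_succ, Fin.prod_univ_succ] at hy
      simp only [Finset.univ_eq_empty, Finset.prod_empty, mul_one] at hy
      change y 0 = τ / (1 + τ)
      have h1 : (1 + τ) ≠ 0 := by
        intro h
        have : τ = -1 := by linarith
        subst this
        linarith
      rw [eq_div_iff h1]
      linarith
    exact measure_mono_null hs (Measure.pi_hyperplane _ 0 _)
  | succ k ih =>
    intro τ
    have hmp := (volume_preserving_piFinSuccAbove (fun _ : Fin (k+1+1) => ℝ) 0)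
    let S : Set (ℝ × (Fin (k+1) → ℝ)) :=
      {p | τ * ((1 - p.1) * ∏ i, (1 - p.2 i)) = p.1 * ∏ i, p.2 i}
    have hS : MeasurableSet S := by
      apply measurableSet_eq_fun <;> fun_prop
    have hpre : {y : Fin (k+1+1) → ℝ | τ * ∏ i, (1 - y i) = ∏ i, y i} =
        (MeasurableEquiv.piFinSuccAbove (fun _ : Fin (k+1+1) => ℝ) 0) ⁻¹' S := by
      ext y
      simp only [S, Set.mem_ofPred_eq, Set.mem_preimage, MeasurableEquiv.piFinSuccAbove_apply]
      rw [Fin.prod_univ_succ, Fin.prod_univ_succ (fun i => y i)]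
      rfl
    rw [hpre, hmp.measure_preimage hS.nullMeasurableSet]
    rw [Measure.volume_eq_prod, Measure.measure_prod_null hS]
    have h0 : ∀ᵐ t : ℝ, t ≠ 0 := Measure.ae_ne volume 0
    filter_upwards [h0] with t ht
    refine measure_mono_null ?_ (ih (τ * (1 - t) / t))
    intro z hz
    simp only [S, Set.mem_ofPred_eq, Set.mem_preimage] at hz ⊢
    rw [div_mul_eq_mul_div, div_eq_iff ht]
    linarith

lemma one_sub_ne (m : ℕ) : ∀ᵐ y : Fin m → ℝ, ∀ i, y i ≠ 1 := by
  rw [ae_all_iff]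
  intro i
  exact Measure.ae_eval_ne _ i 1

def thr {m : ℕ} (w : (Fin m → ℝ) → ℝ) (τ : ℝ) : ℝ :=
  ∫ y in cube m, if τ * ∏ k, (1 - y k) ≤ ∏ k, y k then w y else 0

lemma cube_meas (m : ℕ) : MeasurableSet (cube m) :=
  MeasurableSet.univ_pi fun _ => measurableSet_Icc

lemma cube_P {m : ℕ} {y : Fin m → ℝ} (hy : y ∈ cube m) : 0 ≤ ∏ k, (1 - y k) :=
  Finset.prod_nonneg fun k _ => by have := (hy k (mem_univ _)).2; linarith

lemma cube_Q {m : ℕ} {y : Fin m → ℝ} (hy : y ∈ cube m) : 0 ≤ ∏ k, y k :=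
  Finset.prod_nonneg fun k _ => (hy k (mem_univ _)).1

lemma thr_set {m : ℕ} (τ : ℝ) : MeasurableSet {y : Fin m → ℝ | τ * ∏ k, (1 - y k) ≤ ∏ k, y k} := by
  apply measurableSet_le <;> fun_prop

lemma thr_int {m : ℕ} {w : (Fin m → ℝ) → ℝ} (hw : IntegrableOn w (cube m)) (τ : ℝ) :
    IntegrableOn (fun y => if τ * ∏ k, (1 - y k) ≤ ∏ k, y k then w y else 0) (cube m) := by
  have := Integrable.indicator hw (thr_set (m := m) τ)
  exact this

lemma thr_cont {m : ℕ} (hm : 1 ≤ m) {w : (Fin m → ℝ) → ℝ} (hw : IntegrableOn w (cube m)) :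
    Continuous (thr w) := by
  rw [continuous_iff_continuousAt]
  intro τ
  refine tendsto_integral_filter_of_dominated_convergence (fun y => ‖w y‖) ?_ ?_ hw.norm ?_
  · exact Eventually.of_forall fun t => (thr_int hw t).aestronglyMeasurable
  · refine Eventually.of_forall fun t => Eventually.of_forall fun y => ?_
    split_ifs
    · exact le_rfl
    · simp
  · obtain ⟨k, rfl⟩ : ∃ k, m = k + 1 := ⟨m - 1, by omega⟩
    have h1 : ∀ᵐ y : Fin (k+1) → ℝ, τ * ∏ i, (1 - y i) ≠ ∏ i, y i := by
      have := null_aux k τ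
      rw [ae_iff]; simpa using this
    filter_upwards [ae_restrict_of_ae h1] with y hy
    have hc : ContinuousAt (fun t : ℝ => t * ∏ i, (1 - y i)) τ := by fun_prop
    rcases lt_or_gt_of_ne hy with h | h
    · have : ∀ᶠ t in nhds τ, t * ∏ i, (1 - y i) < ∏ i, y i := hc.eventually_lt continuousAt_const h
      refine tendsto_const_nhds.congr' ?_
      filter_upwards [this] with t ht
      rw [if_pos h.le, if_pos ht.le]
    · have : ∀ᶠ t in nhds τ, ∏ i, y i < t * ∏ i, (1 - y i) :=
        ContinuousAt.eventually_lt continuousAt_const hc h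
      refine tendsto_const_nhds.congr' ?_
      filter_upwards [this] with t ht
      rw [if_neg (not_le.2 h), if_neg (not_le.2 ht)]

lemma thr_lim {m : ℕ} {w : (Fin m → ℝ) → ℝ} (hw : IntegrableOn w (cube m)) :
    Tendsto (thr w) atTop (nhds 0) := by
  have h0 : (0:ℝ) = ∫ y in cube m, (0:ℝ) := by simp
  rw [h0]
  refine tendsto_integral_filter_of_dominated_convergence (fun y => ‖w y‖) ?_ ?_ hw.norm ?_
  · exact Eventually.of_forall fun t => (thr_int hw t).aestronglyMeasurable
  · refine Eventually.of_forall fun t => Eventually.of_forall fun y => ?_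
    split_ifs
    · exact le_rfl
    · simp
  · filter_upwards [ae_restrict_of_ae (one_sub_ne m), ae_restrict_mem (cube_meas m)] with y hy hc
    have hP : 0 < ∏ i, (1 - y i) := Finset.prod_pos fun i _ => by
      have := (hc i (mem_univ _)).2
      have := lt_of_le_of_ne this (hy i)
      linarith
    refine tendsto_const_nhds.congr' ?_
    have : Tendsto (fun t : ℝ => t * ∏ i, (1 - y i)) atTop atTop := tendsto_id.atTop_mul_const hP
    filter_upwards [this.eventually_gt_atTop (∏ i, y i)] with t ht
    rw [if_neg (not_le.2 ht)]

lemma thr_nonneg {m : ℕ} {w : (Fin m → ℝ) → ℝ} (hw : ∀ y ∈ cube m, 0 ≤ w y) (τ : ℝ) :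
    0 ≤ thr w τ := by
  refine setIntegral_nonneg (cube_meas m) fun y hy => ?_
  split_ifs
  · exact hw y hy
  · exact le_rfl

lemma thr_anti {m : ℕ} {w : (Fin m → ℝ) → ℝ} (hw : IntegrableOn w (cube m))
    (hw0 : ∀ y ∈ cube m, 0 ≤ w y) : Antitone (thr w) := by
  intro s t hst
  refine setIntegral_mono_on (thr_int hw t) (thr_int hw s) (cube_meas m) fun y hy => ?_
  have := mul_le_mul_of_nonneg_right hst (cube_P hy)
  split_ifs with h1 h2 h2
  · exact le_rfl
  · exact absurd (this.trans h1) h2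
  · exact hw0 y hy
  · exact le_rfl

lemma thr_zero {m : ℕ} (w : (Fin m → ℝ) → ℝ) : thr w 0 = ∫ y in cube m, w y := by
  refine setIntegral_congr_fun (cube_meas m) fun y hy => ?_
  simp only [zero_mul]
  rw [if_pos (cube_Q hy)]

lemma wplus_eq (f : ℝ → ℝ) {m : ℕ} (y : Fin m → ℝ) :
    wplus f y = (∏ k, y k) * ∏ k, f (y k) := Finset.prod_mul_distrib

lemma wminus_eq (f : ℝ → ℝ) {m : ℕ} (y : Fin m → ℝ) :
    wminus f y = (∏ k, (1 - y k)) * ∏ k, f (y k) := Finset.prod_mul_distrib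

lemma wp_nonneg {f : ℝ → ℝ} (hf : ∀ s, 0 ≤ f s) {m : ℕ} : ∀ y ∈ cube m, 0 ≤ wplus f y := by
  intro y hy
  rw [wplus_eq]
  exact mul_nonneg (cube_Q hy) (Finset.prod_nonneg fun k _ => hf _)

lemma wm_nonneg {f : ℝ → ℝ} (hf : ∀ s, 0 ≤ f s) {m : ℕ} : ∀ y ∈ cube m, 0 ≤ wminus f y := by
  intro y hy
  rw [wminus_eq]
  exact mul_nonneg (cube_P hy) (Finset.prod_nonneg fun k _ => hf _)

/-- Neyman-Pearson. -/
lemma np {f : ℝ → ℝ} (hf : ∀ s, 0 ≤ f s) {m : ℕ}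
    (hp : IntegrableOn (wplus f) (cube m)) (hq : IntegrableOn (wminus f) (cube m))
    (x : (Fin m → ℝ) → ℝ) (hx : Measurable x) (hx1 : ∀ y, x y ∈ Icc (0:ℝ) 1) (τ : ℝ) :
    (∫ y in cube m, x y * wplus f y) - τ * (∫ y in cube m, x y * wminus f y) ≤
      thr (wplus (m := m) f) τ - τ * thr (wminus (m := m) f) τ := by
  have hb : ∀ w : (Fin m → ℝ) → ℝ, IntegrableOn w (cube m) →
      IntegrableOn (fun y => x y * w y) (cube m) := by
    intro w hw
    refine Integrable.bdd_mul (c := 1) hw hx.aestronglyMeasurable ?_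
    refine Eventually.of_forall fun y => ?_
    rw [Real.norm_eq_abs, abs_le]
    exact ⟨by linarith [(hx1 y).1], (hx1 y).2⟩
  unfold thr
  rw [← integral_const_mul, ← integral_const_mul, ← integral_sub (hb _ hp) ((hb _ hq).const_mul τ),
    ← integral_sub (thr_int hp τ) ((thr_int hq τ).const_mul τ)]
  refine setIntegral_mono_on ((hb _ hp).sub ((hb _ hq).const_mul τ))
    ((thr_int hp τ).sub ((thr_int hq τ).const_mul τ)) (cube_meas m) fun y hy => ?_
  rw [wplus_eq, wminus_eq]
  have hF : 0 ≤ ∏ k, f (y k) := Finset.prod_nonneg fun k _ => hf _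
  have h0 := (hx1 y).1
  have h1 := (hx1 y).2
  generalize (∏ k, f (y k)) = F at *
  generalize (∏ k, y k) = Q at *
  generalize (∏ k, (1 - y k)) = P at *
  generalize x y = X at *
  split_ifs with h
  · have := mul_nonneg (mul_nonneg (sub_nonneg.2 h1) (sub_nonneg.2 h)) hF
    nlinarith
  · have := mul_nonneg (mul_nonneg h0 (sub_nonneg.2 (not_le.1 h).le)) hF
    nlinarith

structure InC (a b : ℝ → ℝ) (M A B : ℝ) : Prop where
  b0 : 0 ≤ B
  ba : B ≤ A
  am : A ≤ M
  np : ∀ τ : ℝ, 0 ≤ τ → A - τ * B ≤ a τ - τ * b τ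

structure Adm (a b : ℝ → ℝ) (M L R : ℝ) (A B : ℝ → ℝ) : Prop where
  mem : ∀ s, InC a b M (A s) (B s)
  monoA : Monotone A
  monoB : Monotone B
  ratio : ∀ s t, s ≤ t → A t * B s ≤ A s * B t
  ir : ∀ s ∈ Icc L R, 0 ≤ s * A s - (1 - s) * B s
  ic : ∀ s ∈ Icc L R, ∀ t ∈ Icc L R, s * A t - (1 - s) * B t ≤ s * A s - (1 - s) * B s

lemma ic_mono {L R : ℝ} (hL : 0 ≤ L) (hR : R ≤ 1) {A B : ℝ → ℝ}
    (ic : ∀ s ∈ Icc L R, ∀ t ∈ Icc L R, s * A t - (1 - s) * B t ≤ s * A s - (1 - s) * B s)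
    {s t : ℝ} (hs : s ∈ Icc L R) (ht : t ∈ Icc L R) (hst : s ≤ t) : A s ≤ A t ∧ B s ≤ B t := by
  rcases hst.eq_or_lt with rfl | hst
  · exact ⟨le_rfl, le_rfl⟩
  have h1 := ic s hs t ht
  have h2 := ic t ht s hs
  have s0 : 0 ≤ s := hL.trans hs.1
  have t1 : t ≤ 1 := ht.2.trans hR
  have h3 : 0 ≤ (A t - A s) + (B t - B s) := by
    by_contra h
    have := mul_pos (sub_pos.2 hst) (neg_pos.2 (not_le.1 h))
    nlinarith
  constructor
  · by_contra h
    have h := not_le.1 h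
    have hB : 0 ≤ B t - B s := by linarith
    have := mul_nonneg (sub_nonneg.2 t1) hB
    have := mul_pos (lt_of_le_of_lt s0 hst) (sub_pos.2 h)
    nlinarith
  · by_contra h
    have h := not_le.1 h
    have hB : 0 ≤ A t - A s := by linarith
    have := mul_nonneg s0 hB
    have := mul_pos (sub_pos.2 (lt_of_lt_of_le hst t1)) (sub_pos.2 h)
    nlinarith

lemma ic_ratio {L R : ℝ} (hL : 0 ≤ L) (hR : R ≤ 1) {A B : ℝ → ℝ}
    (ir : ∀ s ∈ Icc L R, 0 ≤ s * A s - (1 - s) * B s)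
    (ic : ∀ s ∈ Icc L R, ∀ t ∈ Icc L R, s * A t - (1 - s) * B t ≤ s * A s - (1 - s) * B s)
    (hB : ∀ s ∈ Icc L R, 0 ≤ B s) (hA : ∀ s ∈ Icc L R, 0 ≤ A s)
    {s t : ℝ} (hs : s ∈ Icc L R) (ht : t ∈ Icc L R) (hst : s ≤ t) : A t * B s ≤ A s * B t := by
  have hm := ic_mono hL hR ic hs ht hst
  have h1 := ic s hs t ht
  have h2 := ir s hs
  rcases (hB s hs).eq_or_lt with h | h
  · rw [← h, mul_zero]; exact mul_nonneg (hA s hs) (hB t ht)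
  have s0 : 0 < s := by
    rcases (hL.trans hs.1).eq_or_lt with h0 | h0
    · rw [← h0] at h2; rw [← h0] at h; linarith
    · exact h0
  have e1 : s * (A t - A s) * B s ≤ (1 - s) * (B t - B s) * B s :=
    mul_le_mul_of_nonneg_right (by linarith) h.le
  have e2 := mul_le_mul_of_nonneg_right h2 (sub_nonneg.2 hm.2)
  have : 0 ≤ s * (A s * B t - A t * B s) := by nlinarith
  have := nonneg_of_mul_nonneg_right this s0
  linarith

/-- Building an admissible pair by clamping. -/
lemma adm_of {a b : ℝ → ℝ} {M L R : ℝ} (hL : 0 ≤ L) (hLR : L < R) (hR : R ≤ 1) {A B : ℝ → ℝ}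
    (mem : ∀ s ∈ Icc L R, InC a b M (A s) (B s))
    (ir : ∀ s ∈ Icc L R, 0 ≤ s * A s - (1 - s) * B s)
    (ic : ∀ s ∈ Icc L R, ∀ t ∈ Icc L R, s * A t - (1 - s) * B t ≤ s * A s - (1 - s) * B s) :
    ∃ A' B' : ℝ → ℝ, Adm a b M L R A' B' ∧ (∀ s ∈ Icc L R, A' s = A s) ∧
      (∀ s ∈ Icc L R, B' s = B s) := by
  let p : ℝ → ℝ := fun s => max L (min s R)
  have hp : ∀ s, p s ∈ Icc L R := fun s => ⟨le_max_left _ _, max_le hLR.le (min_le_right _ _)⟩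
  have hpm : Monotone p := fun s t h => max_le_max le_rfl (min_le_min h le_rfl)
  have hpe : ∀ s ∈ Icc L R, p s = s := fun s hs => by
    simp only [p]; rw [min_eq_left hs.2, max_eq_right hs.1]
  have hB : ∀ s ∈ Icc L R, 0 ≤ B s := fun s hs => (mem s hs).b0
  have hA : ∀ s ∈ Icc L R, 0 ≤ A s := fun s hs => (mem s hs).b0.trans (mem s hs).ba
  refine ⟨fun s => A (p s), fun s => B (p s), ⟨fun s => mem _ (hp s), fun s t h => ?_,
    fun s t h => ?_, fun s t h => ?_, fun s hs => ?_, fun s hs t ht => ?_⟩,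
    fun s hs => ?_, fun s hs => ?_⟩
  · exact (ic_mono hL hR ic (hp s) (hp t) (hpm h)).1
  · exact (ic_mono hL hR ic (hp s) (hp t) (hpm h)).2
  · exact ic_ratio hL hR ir ic hB hA (hp s) (hp t) (hpm h)
  · simp only [hpe s hs]; exact ir s hs
  · simp only [hpe s hs, hpe t ht]; exact ic s hs t ht
  · simp only [hpe s hs]
  · simp only [hpe s hs]

lemma mono_conv {A : ℕ → ℝ → ℝ} {A0 : ℝ → ℝ} (hA : ∀ j, Monotone (A j))
    (hq : ∀ q : ℚ, Tendsto (fun j => A j q) atTop (nhds (A0 q))) {s : ℝ} (hs : ContinuousAt A0 s) :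
    Tendsto (fun j => A j s) atTop (nhds (A0 s)) := by
  rw [tendsto_order]
  constructor
  · intro c hc
    have h1 := (hs.tendsto.eventually (lt_mem_nhds hc))
    obtain ⟨l, hl, h2⟩ := (mem_nhdsLE_iff_exists_Ioc_subset (a := s)).1 (mem_nhdsWithin_of_mem_nhds h1)
    obtain ⟨q, hq1, hq2⟩ := exists_rat_btwn (show l < s from hl)
    have : c < A0 q := h2 ⟨hq1, hq2.le⟩
    filter_upwards [(hq q).eventually (lt_mem_nhds this)] with j hj
    exact hj.trans_le (hA j hq2.le)
  · intro c hc
    have h1 := (hs.tendsto.eventually (gt_mem_nhds hc))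
    obtain ⟨l, hl, h2⟩ := (mem_nhdsGE_iff_exists_Ico_subset (a := s)).1 (mem_nhdsWithin_of_mem_nhds h1)
    obtain ⟨q, hq1, hq2⟩ := exists_rat_btwn (show s < l from hl)
    have : A0 q < c := h2 ⟨hq1.le, hq2⟩
    filter_upwards [(hq q).eventually (gt_mem_nhds this)] with j hj
    exact (hA j hq1.le).trans_lt hj

/-- Helly selection for admissible pairs. -/
lemma helly {a b : ℝ → ℝ} {M L R : ℝ} {A B : ℕ → ℝ → ℝ} (h : ∀ j, Adm a b M L R (A j) (B j)) :
    ∃ (φ : ℕ → ℕ) (A0 B0 : ℝ → ℝ), StrictMono φ ∧ Adm a b M L R A0 B0 ∧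
      (∀ᵐ s : ℝ, Tendsto (fun j => A (φ j) s) atTop (nhds (A0 s))) ∧
      (∀ᵐ s : ℝ, Tendsto (fun j => B (φ j) s) atTop (nhds (B0 s))) := by
  have hK : IsCompact (Icc (0:ℝ) M ×ˢ Icc (0:ℝ) M) := isCompact_Icc.prod isCompact_Icc
  have hin : ∀ j s, (A j s, B j s) ∈ Icc (0:ℝ) M ×ˢ Icc (0:ℝ) M := fun j s =>
    have := (h j).mem s
    ⟨⟨this.b0.trans this.ba, this.am⟩, ⟨this.b0, this.ba.trans this.am⟩⟩
  have hKK : IsCompact (Set.univ.pi fun _ : ℚ => Icc (0:ℝ) M ×ˢ Icc (0:ℝ) M) :=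
    isCompact_univ_pi fun _ => hK
  obtain ⟨z, -, φ, hφ, hz⟩ := hKK.tendsto_subseq (x := fun j (q : ℚ) => (A j q, B j q))
    (fun j q _ => hin j q)
  rw [tendsto_pi_nhds] at hz
  have hlim : ∀ s : ℝ, ∃ p : ℝ × ℝ,
      Tendsto (fun j => (A (φ j) s, B (φ j) s)) (hyperfilter ℕ : Filter ℕ) (nhds p) := by
    intro s
    obtain ⟨p, -, hp⟩ := hK.ultrafilter_le_nhds
      ((hyperfilter ℕ).map fun j => (A (φ j) s, B (φ j) s)) (by
        rw [le_principal_iff]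
        exact Filter.univ_mem' (f := (hyperfilter ℕ : Filter ℕ)) fun j => hin (φ j) s)
    exact ⟨p, hp⟩
  choose p hp using hlim
  have hpA : ∀ s, Tendsto (fun j => A (φ j) s) (hyperfilter ℕ : Filter ℕ) (nhds (p s).1) :=
    fun s => (continuous_fst.tendsto _).comp (hp s)
  have hpB : ∀ s, Tendsto (fun j => B (φ j) s) (hyperfilter ℕ : Filter ℕ) (nhds (p s).2) :=
    fun s => (continuous_snd.tendsto _).comp (hp s)
  have hle : (hyperfilter ℕ : Filter ℕ) ≤ atTop := Nat.hyperfilter_le_atTop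
  have hzp : ∀ q : ℚ, z q = p q := fun q => tendsto_nhds_unique ((hz q).mono_left hle) (hp q)
  have hU : ∀ s : ℝ, ∀ c d, Tendsto (fun j => c * A (φ j) s - d * B (φ j) s) (hyperfilter ℕ : Filter ℕ)
      (nhds (c * (p s).1 - d * (p s).2)) := fun s c d =>
    ((hpA s).const_mul c).sub ((hpB s).const_mul d)
  have hadm : Adm a b M L R (fun s => (p s).1) (fun s => (p s).2) := by
    refine ⟨fun s => ⟨?_, ?_, ?_, fun τ hτ => ?_⟩, fun s t hst => ?_, fun s t hst => ?_,
      fun s t hst => ?_, fun s hs => ?_, fun s hs t ht => ?_⟩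
    · exact ge_of_tendsto' (hpB s) fun j => ((h (φ j)).mem s).b0
    · exact le_of_tendsto_of_tendsto' (hpB s) (hpA s) fun j => ((h (φ j)).mem s).ba
    · exact le_of_tendsto' (hpA s) fun j => ((h (φ j)).mem s).am
    · exact le_of_tendsto' ((hpA s).sub ((hpB s).const_mul τ)) fun j => ((h (φ j)).mem s).np τ hτ
    · exact le_of_tendsto_of_tendsto' (hpA s) (hpA t) fun j => (h (φ j)).monoA hst
    · exact le_of_tendsto_of_tendsto' (hpB s) (hpB t) fun j => (h (φ j)).monoB hst
    · exact le_of_tendsto_of_tendsto' ((hpA t).mul (hpB s)) ((hpA s).mul (hpB t))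
        fun j => (h (φ j)).ratio s t hst
    · exact ge_of_tendsto' (hU s _ _) fun j => (h (φ j)).ir s hs
    · exact le_of_tendsto_of_tendsto' (hU t _ _) (hU s _ _) fun j => (h (φ j)).ic s hs t ht
  refine ⟨φ, fun s => (p s).1, fun s => (p s).2, hφ, hadm, ?_, ?_⟩
  · have := hadm.monoA.countable_not_continuousAt.ae_notMem volume
    filter_upwards [this] with s hs
    refine mono_conv (A := fun j => A (φ j)) (A0 := fun s => (p s).1)
      (fun j => (h (φ j)).monoA) (fun q => ?_) (by simpa using hs)
    have := (continuous_fst.tendsto _).comp (hz q)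
    rw [hzp q] at this
    exact this
  · have := hadm.monoB.countable_not_continuousAt.ae_notMem volume
    filter_upwards [this] with s hs
    refine mono_conv (A := fun j => B (φ j)) (A0 := fun s => (p s).2)
      (fun j => (h (φ j)).monoB) (fun q => ?_) (by simpa using hs)
    have := (continuous_snd.tendsto _).comp (hz q)
    rw [hzp q] at this
    exact this

def W (f : ℝ → ℝ) (L R : ℝ) (A B : ℝ → ℝ) : ℝ := ∫ s in L..R, (s * A s + (1 - s) * B s) * f s

lemma W_bound {s A B M : ℝ} (hs : 0 ≤ s) (hs1 : s ≤ 1) (hA : 0 ≤ A) (hB : 0 ≤ B) (hAM : A ≤ M)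
    (hBM : B ≤ M) : s * A + (1 - s) * B ∈ Icc 0 M := by
  have := mul_nonneg hs hA
  have := mul_nonneg (sub_nonneg.2 hs1) hB
  have := mul_nonneg hs (sub_nonneg.2 hAM)
  have := mul_nonneg (sub_nonneg.2 hs1) (sub_nonneg.2 hBM)
  constructor <;> nlinarith

lemma W_dom {f : ℝ → ℝ} (hf : ∀ s, 0 ≤ f s) {L R : ℝ} (hL : 0 ≤ L) (hR : R ≤ 1)
    {a b : ℝ → ℝ} {M : ℝ} {A B : ℝ → ℝ} (h : Adm a b M L R A B) (s : ℝ) (hs : s ∈ Icc L R) :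
    ‖(s * A s + (1 - s) * B s) * f s‖ ≤ M * f s := by
  have m := h.mem s
  have hb := W_bound (hL.trans hs.1) (hs.2.trans hR) (m.b0.trans m.ba) m.b0 m.am (m.ba.trans m.am)
  rw [Real.norm_eq_abs, abs_of_nonneg (mul_nonneg hb.1 (hf s))]
  exact mul_le_mul_of_nonneg_right hb.2 (hf s)

lemma W_int {f : ℝ → ℝ} (hf : ∀ s, 0 ≤ f s) (hfm : Measurable f) {L R : ℝ} (hL : 0 ≤ L) (hR : R ≤ 1)
    (hLR : L < R) (hfi : IntervalIntegrable f volume L R)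
    {a b : ℝ → ℝ} {M : ℝ} {A B : ℝ → ℝ} (h : Adm a b M L R A B) :
    IntervalIntegrable (fun s => (s * A s + (1 - s) * B s) * f s) volume L R := by
  refine IntervalIntegrable.mono_fun' (hfi.const_mul M) ?_ ?_
  · have := h.monoA.measurable
    have := h.monoB.measurable
    exact Measurable.aestronglyMeasurable (by fun_prop)
  · rw [uIoc_of_le hLR.le]
    filter_upwards [ae_restrict_mem measurableSet_Ioc] with s hs
    exact W_dom hf hL hR h s (Ioc_subset_Icc_self hs)

lemma exists_max {f : ℝ → ℝ} (hf : ∀ s, 0 ≤ f s) (hfm : Measurable f) {L R : ℝ} (hL : 0 ≤ L)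
    (hR : R ≤ 1) (hLR : L < R) (hfi : IntervalIntegrable f volume L R)
    {a b : ℝ → ℝ} {M : ℝ} (hne : ∃ A B, Adm a b M L R A B) :
    ∃ A B, Adm a b M L R A B ∧ ∀ A' B', Adm a b M L R A' B' → W f L R A' B' ≤ W f L R A B := by
  let S : Set ℝ := {v | ∃ A B, Adm a b M L R A B ∧ W f L R A B = v}
  have hSne : S.Nonempty := by
    obtain ⟨A, B, h⟩ := hne
    exact ⟨_, A, B, h, rfl⟩
  have hbdd : BddAbove S := by
    refine ⟨∫ s in L..R, M * f s, ?_⟩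
    rintro v ⟨A, B, h, rfl⟩
    refine intervalIntegral.integral_mono_on hLR.le (W_int hf hfm hL hR hLR hfi h)
      (hfi.const_mul M) fun s hs => ?_
    exact (le_abs_self _).trans (W_dom hf hL hR h s hs)
  obtain ⟨u, -, hu, huS⟩ := exists_seq_tendsto_sSup hSne hbdd
  choose A B hAB hW using huS
  obtain ⟨φ, A0, B0, hφ, h0, hcA, hcB⟩ := helly hAB
  refine ⟨A0, B0, h0, fun A' B' h' => ?_⟩
  have ht : Tendsto (fun j => W f L R (A (φ j)) (B (φ j))) atTop (nhds (W f L R A0 B0)) := by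
    refine intervalIntegral.tendsto_integral_filter_of_dominated_convergence (fun s => M * f s) ?_ ?_
      (hfi.const_mul M) ?_
    · refine Eventually.of_forall fun j => ?_
      have := (hAB (φ j)).monoA.measurable
      have := (hAB (φ j)).monoB.measurable
      exact Measurable.aestronglyMeasurable (by fun_prop)
    · refine Eventually.of_forall fun j => Eventually.of_forall fun s hs => ?_
      rw [uIoc_of_le hLR.le] at hs
      exact W_dom hf hL hR (hAB (φ j)) s (Ioc_subset_Icc_self hs)
    · filter_upwards [hcA, hcB] with s h1 h2 _
      exact ((h1.const_mul s).add (h2.const_mul (1 - s))).mul_const (f s)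
  have ht2 := hu.comp hφ.tendsto_atTop
  have : sSup S = W f L R A0 B0 := by
    refine tendsto_nhds_unique ht2 (ht.congr fun j => ?_)
    exact hW (φ j)
  rw [← this]
  exact le_csSup hbdd ⟨A', B', h', rfl⟩

lemma select_pt {a b : ℝ → ℝ} {M A B : ℝ} (ha : Continuous a) (hb : Continuous b)
    (hba : Antitone b) (ha0 : a 0 = M) (hb0 : b 0 = M)
    (hbl : Tendsto b atTop (nhds 0)) (h : InC a b M A B) (hB : 0 < B) :
    let g := sInf {τ : ℝ | 0 ≤ τ ∧ A * b τ ≤ B * a τ}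
    g ∈ {τ : ℝ | 0 ≤ τ ∧ A * b τ ≤ B * a τ} ∧ A * b g = B * a g ∧ B ≤ b g := by
  intro g
  set Z := {τ : ℝ | 0 ≤ τ ∧ A * b τ ≤ B * a τ} with hZ
  have hbd : BddBelow Z := ⟨0, fun τ hτ => hτ.1⟩
  obtain ⟨T, hT0, hT⟩ : ∃ T : ℝ, 0 ≤ T ∧ b T < B := by
    obtain ⟨T, h1, h2⟩ := ((hbl.eventually (gt_mem_nhds hB)).and (eventually_ge_atTop 0)).exists
    exact ⟨T, h2, h1⟩
  obtain ⟨t1, ht1, hbt1⟩ : B ∈ b '' Icc 0 T := by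
    refine intermediate_value_Icc' hT0 hb.continuousOn ⟨hT.le, ?_⟩
    rw [hb0]; exact h.ba.trans h.am
  have hZ1 : t1 ∈ Z := by
    refine ⟨ht1.1, ?_⟩
    have := h.np t1 ht1.1
    rw [hbt1] at this ⊢
    have : A ≤ a t1 := by linarith
    nlinarith
  have hcl : IsClosed Z := by
    rw [hZ]
    exact (isClosed_le continuous_const continuous_id).inter
      (isClosed_le (continuous_const.mul hb) (continuous_const.mul ha))
  have hg : g ∈ Z := hcl.csInf_mem ⟨_, hZ1⟩ hbd
  refine ⟨hg, ?_, ?_⟩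
  · obtain ⟨t, ht, hte⟩ : (0:ℝ) ∈ (fun τ => B * a τ - A * b τ) '' Icc 0 g := by
      refine intermediate_value_Icc hg.1 (by fun_prop) ⟨?_, ?_⟩
      · simp only [ha0, hb0]
        have := mul_le_mul_of_nonneg_right h.ba (h.b0.trans (h.ba.trans h.am))
        linarith
      · exact sub_nonneg.2 hg.2
    have hte : B * a t - A * b t = 0 := hte
    have : g ≤ t := csInf_le hbd ⟨ht.1, by linarith⟩
    have : t = g := le_antisymm ht.2 this
    rw [this] at hte; linarith
  · rw [← hbt1]
    exact hba (csInf_le hbd hZ1)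

lemma select {a b : ℝ → ℝ} {M L R : ℝ} {A B : ℝ → ℝ} (ha : Continuous a) (hb : Continuous b)
    (hba : Antitone b) (ha0 : a 0 = M) (hb0 : b 0 = M) (hbn : ∀ τ, 0 ≤ b τ)
    (hal : Tendsto a atTop (nhds 0))
    (hbl : Tendsto b atTop (nhds 0)) (h : Adm a b M L R A B) :
    ∃ κ τ : ℝ → ℝ, Measurable κ ∧ Measurable τ ∧ (∀ s, κ s ∈ Icc (0:ℝ) 1) ∧ (∀ s, 0 ≤ τ s) ∧
      (∀ s, κ s * a (τ s) = A s) ∧ (∀ s, κ s * b (τ s) = B s) := by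
  classical
  let g : ℝ → ℝ := fun s => sInf {τ : ℝ | 0 ≤ τ ∧ A s * b τ ≤ B s * a τ}
  let G : ℝ → ENNReal := fun s => if 0 < B s then ENNReal.ofReal (g s) else ⊤
  have hsel : ∀ s, 0 < B s → g s ∈ {τ : ℝ | 0 ≤ τ ∧ A s * b τ ≤ B s * a τ} ∧
      A s * b (g s) = B s * a (g s) ∧ B s ≤ b (g s) := fun s hs =>
    select_pt ha hb hba ha0 hb0 hbl (h.mem s) hs
  have hGa : Antitone G := by
    intro s t hst
    simp only [G]
    by_cases hs : 0 < B s
    · have ht : 0 < B t := hs.trans_le (h.monoB hst)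
      rw [if_pos hs, if_pos ht]
      refine ENNReal.ofReal_le_ofReal (csInf_le ⟨0, fun τ hτ => hτ.1⟩ ⟨(hsel s hs).1.1, ?_⟩)
      have h1 := (hsel s hs).2.1
      have h2 := mul_le_mul_of_nonneg_right (h.ratio s t hst) (hbn (g s))
      have : B s * (A t * b (g s)) ≤ B s * (B t * a (g s)) := by
        calc B s * (A t * b (g s)) = A t * B s * b (g s) := by ring
          _ ≤ A s * B t * b (g s) := h2
          _ = B t * (A s * b (g s)) := by ring
          _ = B s * (B t * a (g s)) := by rw [h1]; ring
      exact le_of_mul_le_mul_left this hs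
    · rw [if_neg hs]; exact le_top
  have hGm : Measurable G := hGa.measurable
  let τ : ℝ → ℝ := fun s => (G s).toReal
  have hτm : Measurable τ := hGm.ennreal_toReal
  have hτe : ∀ s, 0 < B s → τ s = g s := fun s hs => by
    simp only [τ, G, if_pos hs]
    exact ENNReal.toReal_ofReal (hsel s hs).1.1
  refine ⟨fun s => B s / b (τ s), τ, ?_, hτm, ?_, fun s => ENNReal.toReal_nonneg, ?_, ?_⟩
  · exact h.monoB.measurable.div (hb.measurable.comp hτm)
  · intro s
    have h0 := (h.mem s).b0
    refine ⟨div_nonneg h0 (hbn _), ?_⟩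
    change B s / b (τ s) ≤ 1
    rcases h0.eq_or_lt with h0 | h0
    · rw [← h0]; simp
    · rw [hτe s h0]
      have := (hsel s h0).2.2
      exact (div_le_one (h0.trans_le this)).2 this
  · intro s
    have h0 := (h.mem s).b0
    rcases h0.eq_or_lt with h0 | h0
    · have hA : A s ≤ 0 := by
        refine ge_of_tendsto hal ?_
        filter_upwards [eventually_ge_atTop 0] with t ht
        have := (h.mem s).np t ht
        rw [← h0] at this
        have := mul_nonneg ht (hbn t)
        linarith
      have := (h.mem s).ba
      simp only []
      rw [← h0] at this ⊢
      rw [zero_div, zero_mul]; linarith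
    · simp only []
      rw [hτe s h0]
      have h1 := (hsel s h0).2.2
      have h2 := (hsel s h0).2.1
      rw [div_mul_eq_mul_div, div_eq_iff (h0.trans_le h1).ne', h2]
  · intro s
    have h0 := (h.mem s).b0
    rcases h0.eq_or_lt with h0 | h0
    · simp only []
      rw [← h0]; simp
    · simp only []
      rw [hτe s h0]
      exact div_mul_cancel₀ _ (h0.trans_le (hsel s h0).2.2).ne'

section dens
variable {f f' : ℝ → ℝ} {L R : ℝ}

lemma dens_cont (hf : Density f f' L R) : ContinuousOn f (Icc L R) :=
  fun s hs => (hf.hderiv s hs).continuousWithinAt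

lemma dens_ind (hf : Density f f' L R) : (Icc L R).indicator f = f := by
  rw [Set.indicator_eq_self]
  intro s hs
  by_contra h
  exact hs (hf.zero_outside s h)

lemma dens_meas (hf : Density f f' L R) : Measurable f := by
  rw [← dens_ind hf]
  have h2 : Measurable ((Icc L R).domRestrict f) := (dens_cont hf).domRestrict.measurable
  rw [← dens_ind hf] at h2
  refine measurable_of_restrict_of_restrict_compl measurableSet_Icc h2 ?_
  have : (Icc L R)ᶜ.domRestrict ((Icc L R).indicator f) = fun _ => 0 := by
    ext ⟨s, hs⟩
    simp only [Set.domRestrict_apply]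
    exact Set.indicator_of_notMem hs f
  rw [this]
  exact measurable_const

lemma dens_integrable (hf : Density f f' L R) : Integrable f := by
  rw [← dens_ind hf, integrable_indicator_iff measurableSet_Icc]
  exact (dens_cont hf).integrableOn_Icc

lemma dens_integral (hf : Density f f' L R) (hL : 0 ≤ L) (hLR : L < R) (hR : R ≤ 1) (g : ℝ → ℝ) :
    ∫ s in Icc (0:ℝ) 1, g s * f s = ∫ s in L..R, g s * f s := by
  rw [intervalIntegral.integral_of_le hLR.le, ← integral_Icc_eq_integral_Ioc]
  refine setIntegral_eq_of_subset_of_forall_sdiff_eq_zero measurableSet_Icc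
    (Icc_subset_Icc hL hR) fun s hs => ?_
  rw [hf.zero_outside s hs.2, mul_zero]

lemma dens_mul_int (hf : Density f f' L R) {g : ℝ → ℝ} (hg : Continuous g) :
    IntegrableOn (fun s => g s * f s) (Icc (0:ℝ) 1) :=
  IntegrableOn.continuousOn_mul hg.continuousOn (dens_integrable hf).integrableOn isCompact_Icc

lemma wp_int (hf : Density f f' L R) (m : ℕ) : IntegrableOn (wplus (m := m) f) (cube m) := by
  unfold IntegrableOn cube
  rw [volume_pi, Measure.restrict_pi_pi]
  exact Integrable.fintype_prod (f := fun (_ : Fin m) s => s * f s)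
    fun i => dens_mul_int hf (g := fun s => s) continuous_id

lemma wm_int (hf : Density f f' L R) (m : ℕ) : IntegrableOn (wminus (m := m) f) (cube m) := by
  unfold IntegrableOn cube
  rw [volume_pi, Measure.restrict_pi_pi]
  exact Integrable.fintype_prod (f := fun (_ : Fin m) s => (1 - s) * f s)
    fun i => dens_mul_int hf (g := fun s => 1 - s) (by fun_prop)

lemma w_eq (hf : Density f f' L R) (hL : 0 ≤ L) (hLR : L < R) (hR : R ≤ 1) (m : ℕ) :
    ∫ y in cube m, wminus f y = ∫ y in cube m, wplus f y := by
  have h1 : ∫ s in Icc (0:ℝ) 1, (1 - s) * f s = ∫ s in Icc (0:ℝ) 1, s * f s := by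
    rw [dens_integral hf hL hLR hR (fun s => 1 - s), dens_integral hf hL hLR hR (fun s => s), hf.mean]
    have hi : IntervalIntegrable f volume L R := (dens_integrable hf).intervalIntegrable
    have : ∀ s, (1 - s) * f s = f s - s * f s := fun s => by ring
    simp_rw [this]
    rw [intervalIntegral.integral_sub hi (hi.continuousOn_mul (g := fun s => s) continuousOn_id), hf.total, hf.mean]
    norm_num
  unfold cube wminus wplus
  rw [volume_pi, Measure.restrict_pi_pi,
    integral_fintype_prod_eq_prod (fun (_ : Fin m) s => (1 - s) * f s),
    integral_fintype_prod_eq_prod (fun (_ : Fin m) s => s * f s)]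
  simp_rw [h1]

end dens

lemma xint {m : ℕ} {w : (Fin m → ℝ) → ℝ} (hw : IntegrableOn w (cube m)) (hw0 : ∀ y ∈ cube m, 0 ≤ w y)
    (x : (Fin m → ℝ) → ℝ) (hx : Measurable x) (hx1 : ∀ y, x y ∈ Icc (0:ℝ) 1) :
    (∫ y in cube m, x y * w y) ∈ Icc 0 (∫ y in cube m, w y) := by
  constructor
  · exact setIntegral_nonneg (cube_meas m) fun y hy => mul_nonneg (hx1 y).1 (hw0 y hy)
  · refine integral_mono_of_nonneg ?_ hw ?_
    · filter_upwards [ae_restrict_mem (cube_meas m)] with y hy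
      exact mul_nonneg (hx1 y).1 (hw0 y hy)
    · filter_upwards [ae_restrict_mem (cube_meas m)] with y hy
      exact mul_le_of_le_one_left (hw0 y hy) (hx1 y).2

lemma x_bdd {f f' : ℝ → ℝ} {L R : ℝ} (hf : Density f f' L R) {m : ℕ}
    (hwe : ∫ y in cube m, wminus f y = ∫ y in cube m, wplus f y)
    (x : (Fin m → ℝ) → ℝ) (hx : Measurable x) (hx1 : ∀ y, x y ∈ Icc (0:ℝ) 1)
    (hba : (∫ y in cube m, x y * wminus f y) ≤ ∫ y in cube m, x y * wplus f y) :
    InC (thr (wplus (m := m) f)) (thr (wminus (m := m) f)) (∫ y in cube m, wplus f y)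
      (∫ y in cube m, x y * wplus f y) (∫ y in cube m, x y * wminus f y) :=
  ⟨(xint (wm_int hf m) (wm_nonneg hf.nonneg) x hx hx1).1, hba,
    (xint (wp_int hf m) (wp_nonneg hf.nonneg) x hx hx1).2,
    fun τ _ => np hf.nonneg (wp_int hf m) (wm_int hf m) x hx hx1 τ⟩

/-- Improving a feasible mechanism. -/
lemma improve {f f' : ℝ → ℝ} {L R : ℝ} (hL : 0 ≤ L) (hLR : L < R) (hR : R ≤ 1)
    (hf : Density f f' L R) {m : ℕ} (x : ℝ → (Fin m → ℝ) → ℝ) (hx : Feasible f L R x) :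
    ∃ A B, Adm (thr (wplus (m := m) f)) (thr (wminus (m := m) f)) (∫ y in cube m, wplus f y)
      L R A B ∧ Value f L R x ≤ 2 ^ m * W f L R A B := by
  classical
  obtain ⟨⟨hxm, hx1⟩, hir, hic⟩ := hx
  have hwe := w_eq hf hL hLR hR m
  have hxs : ∀ s, Measurable (x s) := fun s => hxm.comp measurable_prodMk_left
  have hc : (0:ℝ) < 2 ^ m := by positivity
  set M := ∫ y in cube m, wplus f y with hM
  have hA : ∀ s, Amap f x s ∈ Icc 0 M := fun s =>
    xint (wp_int hf m) (wp_nonneg hf.nonneg) (x s) (hxs s) (hx1 s)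
  have hB : ∀ s, Bmap f x s ∈ Icc 0 M := fun s => by
    rw [← hwe]
    exact xint (wm_int hf m) (wm_nonneg hf.nonneg) (x s) (hxs s) (hx1 s)
  have hNP : ∀ s, Bmap f x s ≤ Amap f x s → InC (thr (wplus (m := m) f)) (thr (wminus (m := m) f)) M
      (Amap f x s) (Bmap f x s) := fun s hs => x_bdd hf hwe (x s) (hxs s) (hx1 s) hs
  have hMM : InC (thr (wplus (m := m) f)) (thr (wminus (m := m) f)) M M M := by
    have := x_bdd hf hwe (fun _ => 1) measurable_const (fun _ => by simp) (by simp [hwe, hM])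
    simpa [hwe, ← hM] using this
  set A0 := Amap f x with hA0
  set B0 := Bmap f x with hB0
  have ir : ∀ s ∈ Icc L R, 0 ≤ s * A0 s - (1 - s) * B0 s := fun s hs =>
    nonneg_of_mul_nonneg_right (hir s hs) hc
  have ic : ∀ s ∈ Icc L R, ∀ t ∈ Icc L R,
      s * A0 t - (1 - s) * B0 t ≤ s * A0 s - (1 - s) * B0 s := fun s hs t ht =>
    le_of_mul_le_mul_left (hic s hs t ht) hc
  let c : ℝ → Prop := fun s => s * A0 s - (1 - s) * B0 s < s * M - (1 - s) * M
  let A1 : ℝ → ℝ := fun s => if c s then M else A0 s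
  let B1 : ℝ → ℝ := fun s => if c s then M else B0 s
  have hu : ∀ s, s * A1 s - (1 - s) * B1 s =
      max (s * A0 s - (1 - s) * B0 s) (s * M - (1 - s) * M) := by
    intro s
    by_cases h : c s
    · simp only [A1, B1, if_pos h]; exact (max_eq_right (le_of_lt h)).symm
    · simp only [A1, B1, if_neg h]; exact (max_eq_left (not_lt.1 h)).symm
  have hmem : ∀ s ∈ Icc L R, InC (thr (wplus (m := m) f)) (thr (wminus (m := m) f)) M
      (A1 s) (B1 s) := by
    intro s hs
    by_cases h : c s
    · simp only [A1, B1, if_pos h]; exact hMM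
    · simp only [A1, B1, if_neg h]
      refine hNP s ?_
      have h := not_lt.1 h
      have h1 := ir s hs
      have s0 := hL.trans hs.1
      have s1 := hs.2.trans hR
      have a0 := (hA s).1
      have a1 := (hA s).2
      have b0 := (hB s).1
      have b1 := (hB s).2
      by_contra hlt
      have hlt := not_le.1 hlt
      rcases le_or_gt s (1/2) with h2 | h2
      · have := mul_nonneg (by linarith : 0 ≤ 1 - 2 * s) b0
        rcases s0.eq_or_lt with h0 | h0
        · simp only [← h0] at h1 hlt a0; linarith
        · have := mul_pos h0 (sub_pos.2 hlt)
          nlinarith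
      · have e1 := mul_nonneg (by linarith : 0 ≤ 2 * s - 1) (sub_nonneg.2 a1)
        rcases s1.eq_or_lt with h0 | h0
        · simp only [h0] at h hlt b1; linarith
        · have := mul_pos (sub_pos.2 h0) (sub_pos.2 hlt)
          nlinarith
  have ir1 : ∀ s ∈ Icc L R, 0 ≤ s * A1 s - (1 - s) * B1 s := fun s hs => by
    rw [hu]; exact (ir s hs).trans (le_max_left _ _)
  have ic1 : ∀ s ∈ Icc L R, ∀ t ∈ Icc L R,
      s * A1 t - (1 - s) * B1 t ≤ s * A1 s - (1 - s) * B1 s := by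
    intro s hs t ht
    rw [hu s]
    by_cases h : c t
    · simp only [A1, B1, if_pos h]; exact le_max_right _ _
    · simp only [A1, B1, if_neg h]; exact (ic s hs t ht).trans (le_max_left _ _)
  obtain ⟨A, B, hAdm, hAe, hBe⟩ := adm_of hL hLR hR hmem ir1 ic1
  refine ⟨A, B, hAdm, ?_⟩
  unfold Value
  refine mul_le_mul_of_nonneg_left ?_ hc.le
  have hfi : IntervalIntegrable f volume L R := (dens_integrable hf).intervalIntegrable
  unfold W
  rw [intervalIntegral.integral_of_le hLR.le, intervalIntegral.integral_of_le hLR.le]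
  have hI := W_int hf.nonneg (dens_meas hf) hL hR hLR hfi hAdm
  rw [intervalIntegrable_iff_integrableOn_Ioc_of_le hLR.le] at hI
  refine integral_mono_of_nonneg ?_ hI ?_
  · filter_upwards [ae_restrict_mem measurableSet_Ioc] with s hs
    exact mul_nonneg (W_bound (hL.trans hs.1.le) (hs.2.trans hR) (hA s).1 (hB s).1 (hA s).2
      (hB s).2).1 (hf.nonneg s)
  · filter_upwards [ae_restrict_mem measurableSet_Ioc] with s hs
    refine mul_le_mul_of_nonneg_right ?_ (hf.nonneg s)
    have hs' := Ioc_subset_Icc_self hs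
    rw [hAe s hs', hBe s hs']
    by_cases h : c s
    · simp only [A1, B1, if_pos h]
      have := (W_bound (hL.trans hs.1.le) (hs.2.trans hR) (hA s).1 (hB s).1 (hA s).2 (hB s).2).2
      linarith
    · simp only [A1, B1, if_neg h]; exact le_rfl

theorem stmt0 (n : ℕ) (hn : 2 ≤ n) (L R : ℝ) (hL : 0 ≤ L) (hLR : L < R) (hR : R ≤ 1)
    (f f' : ℝ → ℝ) (hf : Density f f' L R) :
    ∃ xstar : ℝ → (Fin (n - 1) → ℝ) → ℝ, ∃ κ τ : ℝ → ℝ,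
      Feasible f L R xstar ∧
      (∀ s ∈ Set.Icc L R, κ s ∈ Set.Icc (0:ℝ) 1 ∧ 0 ≤ τ s) ∧
      (∀ s ∈ Set.Icc L R, ∀ y ∈ cube (n - 1),
        xstar s y = if τ s * ∏ k, (1 - y k) ≤ ∏ k, y k then κ s else 0) ∧
      (∀ x : ℝ → (Fin (n - 1) → ℝ) → ℝ, Feasible f L R x →
        Value f L R x ≤ Value f L R xstar) := by

  generalize hm : n - 1 = m
  have hm1 : 1 ≤ m := by omega
  have hwe := w_eq hf hL hLR hR m
  have hwp := wp_int hf m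
  have hwm := wm_int hf m
  have hnp := wp_nonneg (m := m) hf.nonneg
  have hnm := wm_nonneg (m := m) hf.nonneg
  have hfi : IntervalIntegrable f volume L R := (dens_integrable hf).intervalIntegrable
  have hc : (0:ℝ) < 2 ^ m := by positivity
  have hne : ∃ A B, Adm (thr (wplus (m := m) f)) (thr (wminus (m := m) f))
      (∫ y in cube m, wplus f y) L R A B := by
    have h0 : InC (thr (wplus (m := m) f)) (thr (wminus (m := m) f))
      (∫ y in cube m, wplus f y) 0 0 := by
      have := x_bdd hf hwe (fun _ => 0) measurable_const (fun _ => by simp) (by simp)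
      simpa using this
    exact ⟨fun _ => 0, fun _ => 0, fun _ => h0, monotone_const, monotone_const, by simp, by simp,
      by simp⟩
  obtain ⟨A, B, hAB, hmax⟩ := exists_max hf.nonneg (dens_meas hf) hL hR hLR hfi hne
  obtain ⟨κ, τ, hκm, hτm, hκ, hτ, hκA, hκB⟩ := select (thr_cont hm1 hwp) (thr_cont hm1 hwm)
    (thr_anti hwm hnm) (thr_zero _) ((thr_zero _).trans hwe) (thr_nonneg hnm) (thr_lim hwp)
    (thr_lim hwm) hAB
  let xs : ℝ → (Fin m → ℝ) → ℝ :=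
    fun s y => if τ s * ∏ k, (1 - y k) ≤ ∏ k, y k then κ s else 0
  have hgen : ∀ (w : (Fin m → ℝ) → ℝ) s, ∫ y in cube m, xs s y * w y = κ s * thr w (τ s) := by
    intro w s
    unfold thr
    rw [← integral_const_mul]
    congr 1
    ext y
    simp only [xs]
    split_ifs <;> simp
  have hA : ∀ s, Amap f xs s = A s := fun s => (hgen _ s).trans (hκA s)
  have hB : ∀ s, Bmap f xs s = B s := fun s => (hgen _ s).trans (hκB s)
  have hV : Value f L R xs = 2 ^ m * W f L R A B := by
    unfold Value W
    simp_rw [hA, hB]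
  refine ⟨xs, κ, τ, ⟨⟨?_, ?_⟩, ?_, ?_⟩, fun s _ => ⟨hκ s, hτ s⟩, fun s _ y _ => rfl, ?_⟩
  · refine Measurable.ite (measurableSet_le ?_ ?_) (hκm.comp measurable_fst) measurable_const
    · exact (hτm.comp measurable_fst).mul (by fun_prop)
    · fun_prop
  · intro s y
    simp only [xs]
    split_ifs
    · exact hκ s
    · simp
  · intro s hs
    unfold Upay
    rw [hA, hB]
    exact mul_nonneg hc.le (hAB.ir s hs)
  · intro s hs t ht
    unfold Upay
    simp only [hA, hB]
    exact mul_le_mul_of_nonneg_left (hAB.ic s hs t ht) hc.le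
  · intro x hx
    obtain ⟨A', B', h', hle⟩ := improve hL hLR hR hf x hx
    rw [hV]
    exact hle.trans (mul_le_mul_of_nonneg_left (hmax A' B' h') hc.le)
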